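/- Let ℒ be an intuitionistic abstract logic. Then its space X = PTh of prime theories is a spectral space with implication: X is spectral, and for all a, b ∈ Expr the set a^X → b^X := { P ∈ X : for every prime theory P' ⊇ P, P' ∈ a^X implies P' ∈ b^X } equals (a → b)^X and in particular belongs to Λ(X). -/

import Mathlib

/-- An abstract logic: a nonempty family of theories on `Expr`
closed under intersections of nonempty subfamilies. -/
def IsAbstractLogic {Expr : Type*} (Th : Set (Set Expr)) : Prop :=
  Th.Nonempty ∧ ∀ 𝒯 ⊆ Th, 𝒯.Nonempty → ⋂₀ 𝒯 ∈ Th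

/-- The logic is closed under chains: the union of every nonempty chain of
theories is a theory. -/
def ChainClosed {Expr : Type*} (Th : Set (Set Expr)) : Prop :=
  ∀ 𝒯 ⊆ Th, 𝒯.Nonempty → IsChain (· ⊆ ·) 𝒯 → ⋃₀ 𝒯 ∈ Th

/-- A theory is totally prime if whenever it is the intersection of a nonempty
family of theories, it belongs to that family. -/
def TotallyPrimeTheory {Expr : Type*} (Th : Set (Set Expr)) (T : Set Expr) : Prop :=
  T ∈ Th ∧ ∀ 𝒯 ⊆ Th, 𝒯.Nonempty → T = ⋂₀ 𝒯 → T ∈ 𝒯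

/-- A theory is prime if whenever it is the intersection of two theories,
it equals one of them. -/
def PrimeTheory {Expr : Type*} (Th : Set (Set Expr)) (T : Set Expr) : Prop :=
  T ∈ Th ∧ ∀ T₁ ∈ Th, ∀ T₂ ∈ Th, T = T₁ ∩ T₂ → T = T₁ ∨ T = T₂

/-- A distributive abstract logic: an abstract logic closed under chains with
binary operations `vee` (disjunction) and `wedge` (conjunction) behaving as
expected on all totally prime theories. -/
def IsDistributiveLogic {Expr : Type*} (Th : Set (Set Expr))
    (vee wedge : Expr → Expr → Expr) : Prop :=
  IsAbstractLogic Th ∧ ChainClosed Th ∧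
  (∀ T, TotallyPrimeTheory Th T → ∀ a b, vee a b ∈ T ↔ (a ∈ T ∨ b ∈ T)) ∧
  (∀ T, TotallyPrimeTheory Th T → ∀ a b, wedge a b ∈ T ↔ (a ∈ T ∧ b ∈ T))

/-- The space of a distributive abstract logic: the set of its prime theories. -/
structure LogicSpace {Expr : Type*} (Th : Set (Set Expr)) where
  val : Set Expr
  prime : PrimeTheory Th val

/-- The basic open set `a^X = { P ∈ PTh | a ∈ P }`. -/
def basicSet {Expr : Type*} (Th : Set (Set Expr)) (a : Expr) : Set (LogicSpace Th) :=
  {P | a ∈ P.val}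

/-- The topology on the space of prime theories generated by the base
`Λ(X) = { a^X | a ∈ Expr }`. -/
instance {Expr : Type*} (Th : Set (Set Expr)) : TopologicalSpace (LogicSpace Th) :=
  TopologicalSpace.generateFrom (Set.range (basicSet Th))

/-- A spectral space: compact, T₀, the compact opens form a base closed under
finite (binary) intersections, and every nonempty irreducible closed subset
has a generic point (i.e. the space is quasi-sober). -/
def IsSpectral (X : Type*) [TopologicalSpace X] : Prop :=
  CompactSpace X ∧ T0Space X ∧
  TopologicalSpace.IsTopologicalBasis {U : Set X | IsOpen U ∧ IsCompact U} ∧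
  (∀ U V : Set X, IsOpen U → IsCompact U → IsOpen V → IsCompact V →
    IsOpen (U ∩ V) ∧ IsCompact (U ∩ V)) ∧
  QuasiSober X

/-- A set of expressions is consistent if it is contained in some theory. -/
def ConsistentSet {Expr : Type*} (Th : Set (Set Expr)) (A : Set Expr) : Prop :=
  ∃ T ∈ Th, A ⊆ T

/-- An intuitionistic abstract logic: a distributive abstract logic on a
nonempty set of expressions with negation `neg` and implication `imp`
satisfying the intuitionistic conditions on all totally prime theories. -/
def IsIntuitionisticLogic {Expr : Type*} (Th : Set (Set Expr))
    (vee wedge : Expr → Expr → Expr) (neg : Expr → Expr)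
    (imp : Expr → Expr → Expr) : Prop :=
  Nonempty Expr ∧ IsDistributiveLogic Th vee wedge ∧
  (∀ T, TotallyPrimeTheory Th T → ∀ a, neg a ∈ T ↔ ¬ ConsistentSet Th (T ∪ {a})) ∧
  (∀ T, TotallyPrimeTheory Th T → ∀ a b,
    imp a b ∈ T ↔ ∀ T', TotallyPrimeTheory Th T' → T ⊆ T' → a ∈ T' → b ∈ T')

section Theories

open Set TopologicalSpace

variable {Expr : Type*} {Th : Set (Set Expr)} {vee wedge : Expr → Expr → Expr}
  {neg : Expr → Expr} {imp : Expr → Expr → Expr}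

theorem TotallyPrimeTheory.primeTheory {T : Set Expr} (hT : TotallyPrimeTheory Th T) :
    PrimeTheory Th T := by
  refine ⟨hT.1, fun T₁ h₁ T₂ h₂ h => ?_⟩
  have := hT.2 {T₁, T₂} (by rintro _ (rfl | rfl) <;> assumption) ⟨T₁, by simp⟩ (by simpa using h)
  simpa using this

theorem ChainClosed.exists_maximal_disjoint (hc : ChainClosed Th) {T I : Set Expr} (hT : T ∈ Th)
    (hd : Disjoint T I) : ∃ M, T ⊆ M ∧ Maximal (fun S => S ∈ Th ∧ Disjoint S I) M := by
  refine zorn_subset_nonempty {S | S ∈ Th ∧ Disjoint S I} (fun c hcs hch hne => ?_) T ⟨hT, hd⟩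
  exact ⟨⋃₀ c, ⟨hc c (fun S hS => (hcs hS).1) hne hch,
    disjoint_sUnion_left.2 fun S hS => (hcs hS).2⟩, fun S hS => subset_sUnion_of_mem hS⟩

/-- A theory omitting `a` extends to a totally prime theory omitting `a`. -/
theorem ChainClosed.exists_totallyPrime_notMem (hc : ChainClosed Th) {T : Set Expr} (hT : T ∈ Th)
    {a : Expr} (ha : a ∉ T) : ∃ M, T ⊆ M ∧ TotallyPrimeTheory Th M ∧ a ∉ M := by
  obtain ⟨M, hTM, hM⟩ := hc.exists_maximal_disjoint hT (disjoint_singleton_right.2 ha)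
  have haM : a ∉ M := disjoint_singleton_right.1 hM.prop.2
  refine ⟨M, hTM, ⟨hM.prop.1, fun F hF _ hMF => ?_⟩, haM⟩
  have haF : a ∉ ⋂₀ F := hMF ▸ haM
  simp only [mem_sInter, not_forall] at haF
  obtain ⟨S, hS, haS⟩ := haF
  have hMS : M ⊆ S := hMF.subset.trans (sInter_subset_of_mem hS)
  rwa [hM.eq_of_subset ⟨hF hS, disjoint_singleton_right.2 haS⟩ hMS]

/-- Membership in a theory is tested on its totally prime extensions. -/
theorem ChainClosed.mem_iff_forall_totallyPrime (hc : ChainClosed Th) {T : Set Expr} (hT : T ∈ Th)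
    {a : Expr} : a ∈ T ↔ ∀ M, TotallyPrimeTheory Th M → T ⊆ M → a ∈ M := by
  refine ⟨fun h M _ hTM => hTM h, fun h => ?_⟩
  by_contra ha
  obtain ⟨M, hTM, hM, haM⟩ := hc.exists_totallyPrime_notMem hT ha
  exact haM (h M hM hTM)

namespace IsDistributiveLogic

theorem vee_mem_left (h : IsDistributiveLogic Th vee wedge) {T : Set Expr} (hT : T ∈ Th)
    {a : Expr} (b : Expr) (ha : a ∈ T) : vee a b ∈ T :=
  (h.2.1.mem_iff_forall_totallyPrime hT).2 fun M hM hTM => (h.2.2.1 M hM a b).2 (.inl (hTM ha))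

theorem vee_mem_right (h : IsDistributiveLogic Th vee wedge) {T : Set Expr} (hT : T ∈ Th)
    (a : Expr) {b : Expr} (hb : b ∈ T) : vee a b ∈ T :=
  (h.2.1.mem_iff_forall_totallyPrime hT).2 fun M hM hTM => (h.2.2.1 M hM a b).2 (.inr (hTM hb))

theorem wedge_mem_iff (h : IsDistributiveLogic Th vee wedge) {T : Set Expr} (hT : T ∈ Th)
    {a b : Expr} : wedge a b ∈ T ↔ a ∈ T ∧ b ∈ T := by
  simp only [h.2.1.mem_iff_forall_totallyPrime hT, ← forall_and]
  exact forall₃_congr fun M hM _ => h.2.2.2 M hM a b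

theorem vee_mem_iff (h : IsDistributiveLogic Th vee wedge) {P : Set Expr} (hP : PrimeTheory Th P)
    {a b : Expr} : vee a b ∈ P ↔ a ∈ P ∨ b ∈ P := by
  refine ⟨fun hab => ?_, fun hab => hab.elim (h.vee_mem_left hP.1 b) (h.vee_mem_right hP.1 a)⟩
  have key : ∀ c d : Expr, (∀ M, TotallyPrimeTheory Th M → P ⊆ M → c ∈ M ∨ d ∈ M) →
      (¬ ∃ M, TotallyPrimeTheory Th M ∧ P ⊆ M ∧ c ∈ M) → d ∈ P := fun c d hcd hc =>
    (h.2.1.mem_iff_forall_totallyPrime hP.1).2 fun M hM hPM =>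
      (hcd M hM hPM).resolve_left fun hcM => hc ⟨M, hM, hPM, hcM⟩
  have hor : ∀ M, TotallyPrimeTheory Th M → P ⊆ M → a ∈ M ∨ b ∈ M := fun M hM hPM =>
    (h.2.2.1 M hM a b).1 (hPM hab)
  by_cases hea : ∃ M, TotallyPrimeTheory Th M ∧ P ⊆ M ∧ a ∈ M
  swap
  · exact .inr (key a b hor hea)
  by_cases heb : ∃ M, TotallyPrimeTheory Th M ∧ P ⊆ M ∧ b ∈ M
  swap
  · exact .inl (key b a (fun M hM hPM => (hor M hM hPM).symm) heb)
  have hmem : ∀ c, (∃ M, TotallyPrimeTheory Th M ∧ P ⊆ M ∧ c ∈ M) →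
      ⋂₀ {M | TotallyPrimeTheory Th M ∧ P ⊆ M ∧ c ∈ M} ∈ Th := fun c hc =>
    h.1.2 _ (fun M hM => hM.1.1) hc
  have hinter : P = ⋂₀ {M | TotallyPrimeTheory Th M ∧ P ⊆ M ∧ a ∈ M} ∩
      ⋂₀ {M | TotallyPrimeTheory Th M ∧ P ⊆ M ∧ b ∈ M} := by
    refine subset_antisymm
      (subset_inter (fun x hx M hM => hM.2.1 hx) fun x hx M hM => hM.2.1 hx) fun x hx => ?_
    refine (h.2.1.mem_iff_forall_totallyPrime hP.1).2 fun M hM hPM => ?_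
    exact (hor M hM hPM).elim (fun ha => hx.1 M ⟨hM, hPM, ha⟩) fun hb => hx.2 M ⟨hM, hPM, hb⟩
  exact (hP.2 _ (hmem a hea) _ (hmem b heb) hinter).imp
    (fun hPa => hPa.symm.subset fun M hM => hM.2.2) fun hPb => hPb.symm.subset fun M hM => hM.2.2

/-- The prime filter theorem: a theory maximal among those disjoint from a set closed under
disjunctions is prime. -/
theorem primeTheory_of_maximal_disjoint (h : IsDistributiveLogic Th vee wedge) {M I : Set Expr}
    (hI : ∀ x ∈ I, ∀ y ∈ I, vee x y ∈ I) (hM : Maximal (fun S => S ∈ Th ∧ Disjoint S I) M) :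
    PrimeTheory Th M := by
  refine ⟨hM.prop.1, fun T₁ h₁ T₂ h₂ hMT => ?_⟩
  by_contra! hne
  have hit : ∀ T ∈ Th, M ⊆ T → M ≠ T → ∃ x ∈ T, x ∈ I := fun T hT hMT hne =>
    not_disjoint_iff.1 fun hd => hne (hM.eq_of_subset ⟨hT, hd⟩ hMT)
  obtain ⟨x, hx, hxI⟩ := hit T₁ h₁ (hMT.subset.trans inter_subset_left) hne.1
  obtain ⟨y, hy, hyI⟩ := hit T₂ h₂ (hMT.subset.trans inter_subset_right) hne.2
  have hxy : vee x y ∈ M := by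
    rw [hMT]
    exact ⟨h.vee_mem_left h₁ y hx, h.vee_mem_right h₂ x hy⟩
  exact disjoint_left.1 hM.prop.2 hxy (hI x hxI y hyI)

theorem isCompact_basicSet (h : IsDistributiveLogic Th vee wedge) (a : Expr) :
    IsCompact (basicSet Th a) := by
  refine isCompact_generateFrom rfl fun C hC hcov => ?_
  by_cases hT : ∃ T ∈ Th, a ∈ T
  swap
  · exact ⟨∅, empty_subset _, finite_empty, fun P hP => (hT ⟨_, P.prime.1, hP⟩).elim⟩
  by_contra hfin
  let I : Set Expr := {x | ∃ Q ⊆ C, Q.Finite ∧ basicSet Th x ⊆ ⋃₀ Q}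
  have hI : ∀ x ∈ I, ∀ y ∈ I, vee x y ∈ I := by
    rintro x ⟨Q, hQ, hQf, hx⟩ y ⟨R, hR, hRf, hy⟩
    refine ⟨Q ∪ R, union_subset hQ hR, hQf.union hRf, fun P hP => ?_⟩
    rw [sUnion_union]
    exact ((h.vee_mem_iff P.prime).1 hP).imp (fun hx' => hx hx') fun hy' => hy hy'
  have hd : Disjoint (⋂₀ {T | T ∈ Th ∧ a ∈ T}) I := by
    refine disjoint_left.2 fun x hx hxI => ?_
    obtain ⟨Q, hQ, hQf, hxQ⟩ := hxI
    exact hfin ⟨Q, hQ, hQf, fun P hP => hxQ (hx P.val ⟨P.prime.1, hP⟩)⟩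
  obtain ⟨M, hTM, hM⟩ :=
    h.2.1.exists_maximal_disjoint (h.1.2 {T | T ∈ Th ∧ a ∈ T} (fun T hT => hT.1) hT) hd
  let P : LogicSpace Th := ⟨M, h.primeTheory_of_maximal_disjoint hI hM⟩
  have haP : P ∈ basicSet Th a := hTM fun T hT => hT.2
  obtain ⟨U, hU, hPU⟩ := hcov haP
  obtain ⟨b, rfl⟩ := hC hU
  exact disjoint_left.1 hM.prop.2 hPU
    ⟨{basicSet Th b}, singleton_subset_iff.2 hU, finite_singleton _, by simp⟩

theorem basicSet_inter (h : IsDistributiveLogic Th vee wedge) (a b : Expr) :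
    basicSet Th a ∩ basicSet Th b = basicSet Th (wedge a b) :=
  Set.ext fun P => (h.wedge_mem_iff P.prime.1).symm

end IsDistributiveLogic

theorem isOpen_basicSet (a : Expr) : IsOpen (basicSet Th a) :=
  isOpen_generateFrom_of_mem (mem_range_self a)

namespace IsIntuitionisticLogic

theorem imp_mem_iff (h : IsIntuitionisticLogic Th vee wedge neg imp) {T : Set Expr} (hT : T ∈ Th)
    {a b : Expr} :
    imp a b ∈ T ↔ ∀ M, TotallyPrimeTheory Th M → T ⊆ M → a ∈ M → b ∈ M := by
  rw [h.2.1.2.1.mem_iff_forall_totallyPrime hT]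
  exact ⟨fun H M hM hTM => (h.2.2.2 M hM a b).1 (H M hM hTM) M hM subset_rfl,
    fun H M hM hTM => (h.2.2.2 M hM a b).2 fun M' hM' hMM' => H M' hM' (hTM.trans hMM')⟩

theorem imp_self_mem (h : IsIntuitionisticLogic Th vee wedge neg imp) {T : Set Expr} (hT : T ∈ Th)
    (a : Expr) : imp a a ∈ T :=
  (h.imp_mem_iff hT).2 fun _ _ _ => id

theorem imp_mem_iff_forall_prime (h : IsIntuitionisticLogic Th vee wedge neg imp) {T : Set Expr}
    (hT : T ∈ Th) {a b : Expr} :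
    imp a b ∈ T ↔ ∀ P, PrimeTheory Th P → T ⊆ P → a ∈ P → b ∈ P := by
  refine ⟨fun hab P hP hTP ha => ?_, fun hab => (h.imp_mem_iff hT).2 fun M hM =>
    hab M hM.primeTheory⟩
  exact (h.2.1.2.1.mem_iff_forall_totallyPrime hP.1).2 fun M hM hPM =>
    (h.imp_mem_iff hT).1 hab M hM (hTP.trans hPM) (hPM ha)

theorem neg_imp_self_notMem (h : IsIntuitionisticLogic Th vee wedge neg imp) {T : Set Expr}
    (hT : T ∈ Th) (a : Expr) : neg (imp a a) ∉ T := by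
  have key : ∀ M, TotallyPrimeTheory Th M → neg (imp a a) ∉ M := fun M hM hn =>
    (h.2.2.1 M hM _).1 hn ⟨M, hM.1, union_subset subset_rfl
      (singleton_subset_iff.2 (h.imp_self_mem hM.1 a))⟩
  intro hn
  by_cases hex : ∃ M, TotallyPrimeTheory Th M ∧ T ⊆ M
  · obtain ⟨M, hM, hTM⟩ := hex
    exact key M hM (hTM hn)
  · push Not at hex
    have huniv : T = univ := eq_univ_of_forall fun x =>
      (h.2.1.2.1.mem_iff_forall_totallyPrime hT).2 fun M hM hTM => (hex M hM hTM).elim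
    refine hex T ⟨hT, fun F hF hne hTF => ?_⟩ subset_rfl
    obtain ⟨S, hS⟩ := hne
    have : T = S := subset_antisymm (hTF.subset.trans (sInter_subset_of_mem hS))
      (huniv ▸ subset_univ S)
    exact this ▸ hS

theorem isTopologicalBasis_range_basicSet (h : IsIntuitionisticLogic Th vee wedge neg imp) :
    IsTopologicalBasis (range (basicSet Th)) := by
  refine isTopologicalBasis_of_subbasis_of_finiteInter rfl ⟨?_, ?_⟩
  · obtain ⟨a⟩ := h.1
    exact ⟨imp a a, eq_univ_of_forall fun P => h.imp_self_mem P.prime.1 a⟩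
  · rintro _ ⟨a, rfl⟩ _ ⟨b, rfl⟩
    exact ⟨wedge a b, (h.2.1.basicSet_inter a b).symm⟩

theorem specializes_iff (h : IsIntuitionisticLogic Th vee wedge neg imp) {P Q : LogicSpace Th} :
    P ⤳ Q ↔ Q.val ⊆ P.val := by
  rw [specializes_iff_mem_closure, h.isTopologicalBasis_range_basicSet.mem_closure_iff]
  simp [basicSet, subset_def]

/-- The union of the members of an irreducible set of prime theories is a prime theory. -/
theorem primeTheory_biUnion (h : IsIntuitionisticLogic Th vee wedge neg imp)
    {Z : Set (LogicSpace Th)} (hZ : IsIrreducible Z) : PrimeTheory Th (⋃ P ∈ Z, P.val) := by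
  set A : Set Expr := ⋃ P ∈ Z, P.val with hA
  have memA : ∀ {x}, x ∈ A ↔ ∃ P ∈ Z, x ∈ P.val := by simp [hA]
  have hwedge : ∀ x ∈ A, ∀ y ∈ A, ∃ P ∈ Z, x ∈ P.val ∧ y ∈ P.val := fun x hx y hy =>
    hZ.2 _ _ (isOpen_basicSet x) (isOpen_basicSet y) (memA.1 hx) (memA.1 hy)
  obtain ⟨P₀, hP₀⟩ := hZ.1
  have hP₀A : P₀.val ⊆ A := fun x hx => memA.2 ⟨P₀, hP₀, hx⟩
  obtain ⟨M, -, hM⟩ := h.2.1.2.1.exists_maximal_disjoint P₀.prime.1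
    (disjoint_compl_right_iff_subset.2 hP₀A)
  have hMA : M ⊆ A := disjoint_compl_right_iff_subset.1 hM.prop.2
  have hprime : PrimeTheory Th M := by
    refine h.2.1.primeTheory_of_maximal_disjoint (I := Aᶜ) ?_ hM
    intro x hx y hy hxy
    obtain ⟨P, hP, hxyP⟩ := memA.1 hxy
    exact ((h.2.1.vee_mem_iff P.prime).1 hxyP).elim (fun h' => hx (memA.2 ⟨P, hP, h'⟩))
      fun h' => hy (memA.2 ⟨P, hP, h'⟩)
  have mp_mem : ∀ a ∈ A, ∀ c, imp a c ∈ M → c ∈ A := fun a ha c hac => by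
    obtain ⟨P, hP, haP, hacP⟩ := hwedge a ha _ (hMA hac)
    exact memA.2 ⟨P, hP, (h.imp_mem_iff_forall_prime P.prime.1).1 hacP _ P.prime subset_rfl haP⟩
  suffices A ⊆ M from subset_antisymm this hMA ▸ hprime
  intro a ha
  let F : Set (Set Expr) := {Q | TotallyPrimeTheory Th Q ∧ M ⊆ Q ∧ a ∈ Q}
  have hF : F.Nonempty := by
    by_contra hF
    obtain ⟨P, -, hP⟩ := memA.1 <| mp_mem a ha (neg (imp a a)) <|
      (h.imp_mem_iff hprime.1).2 fun Q hQ hMQ haQ => (hF ⟨Q, hQ, hMQ, haQ⟩).elim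
    exact h.neg_imp_self_notMem P.prime.1 a hP
  have hFA : ⋂₀ F ⊆ A := fun c hc => mp_mem a ha c <|
    (h.imp_mem_iff hprime.1).2 fun Q hQ hMQ haQ => hc Q ⟨hQ, hMQ, haQ⟩
  have hMF : M = ⋂₀ F := hM.eq_of_subset
    ⟨h.2.1.1.2 F (fun Q hQ => hQ.1.1) hF, disjoint_compl_right_iff_subset.2 hFA⟩
    (subset_sInter fun Q hQ => hQ.2.1)
  rw [hMF]
  exact fun Q hQ => hQ.2.2

theorem quasiSober (h : IsIntuitionisticLogic Th vee wedge neg imp) :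
    QuasiSober (LogicSpace Th) where
  sober {Z} hZ hclosed := by
    let G : LogicSpace Th := ⟨⋃ P ∈ Z, P.val, h.primeTheory_biUnion hZ⟩
    have hGZ : G ∈ Z := by
      rw [← hclosed.closure_eq, h.isTopologicalBasis_range_basicSet.mem_closure_iff]
      rintro _ ⟨a, rfl⟩ ha
      obtain ⟨P, hP, haP⟩ := mem_iUnion₂.1 ha
      exact ⟨P, haP, hP⟩
    refine ⟨G, isGenericPoint_iff_specializes.2 fun Q => ⟨fun hs => hs.mem_closed hclosed hGZ,
      fun hQ => h.specializes_iff.2 (subset_biUnion_of_mem (u := LogicSpace.val) hQ)⟩⟩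

theorem isSpectral (h : IsIntuitionisticLogic Th vee wedge neg imp) :
    IsSpectral (LogicSpace Th) := by
  have basis := h.isTopologicalBasis_range_basicSet
  have hcompact := h.2.1.isCompact_basicSet
  refine ⟨?_, ?_, (PrespectralSpace.of_isTopologicalBasis' basis hcompact).isTopologicalBasis,
    fun U V hU hUc hV hVc => ⟨hU.inter hV, ?_⟩, h.quasiSober⟩
  · obtain ⟨a⟩ := h.1
    refine ⟨?_⟩
    convert hcompact (imp a a)
    exact (eq_univ_of_forall fun P => h.imp_self_mem P.prime.1 a).symm
  · refine (t0Space_iff_inseparable _).2 fun ⟨P, hP⟩ ⟨Q, hQ⟩ hPQ => ?_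
    obtain rfl : P = Q := subset_antisymm (h.specializes_iff.1 hPQ.specializes')
      (h.specializes_iff.1 hPQ.specializes)
    rfl
  · have := QuasiSeparatedSpace.of_isTopologicalBasis basis fun a b =>
      h.2.1.basicSet_inter a b ▸ hcompact (wedge a b)
    exact this.inter_isCompact U V hU hUc hV hVc

theorem implicationSet_eq_basicSet (h : IsIntuitionisticLogic Th vee wedge neg imp) (a b : Expr) :
    {P : LogicSpace Th | ∀ P' : LogicSpace Th,
      P.val ⊆ P'.val → P' ∈ basicSet Th a → P' ∈ basicSet Th b} = basicSet Th (imp a b) :=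
  Set.ext fun P => Iff.trans ⟨fun hP Q hQ => hP ⟨Q, hQ⟩, fun hP P' => hP P'.val P'.prime⟩
    (h.imp_mem_iff_forall_prime P.prime.1).symm

end IsIntuitionisticLogic

end Theories


/-- The space of prime theories of an intuitionistic abstract
logic is a spectral space with implication: it is spectral, and for all
expressions `a, b` the set `a^X → b^X` equals `(a → b)^X`, which in
particular belongs to the base `Λ(X)`. -/
theorem intuitionistic_space_spectral_with_implication {Expr : Type*}
    (Th : Set (Set Expr)) (vee wedge : Expr → Expr → Expr) (neg : Expr → Expr)
    (imp : Expr → Expr → Expr) (hI : IsIntuitionisticLogic Th vee wedge neg imp) :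
    IsSpectral (LogicSpace Th) ∧
    ∀ a b : Expr,
      {P : LogicSpace Th | ∀ P' : LogicSpace Th,
          P.val ⊆ P'.val → P' ∈ basicSet Th a → P' ∈ basicSet Th b}
        = basicSet Th (imp a b) ∧
      {P : LogicSpace Th | ∀ P' : LogicSpace Th,
          P.val ⊆ P'.val → P' ∈ basicSet Th a → P' ∈ basicSet Th b}
        ∈ Set.range (basicSet Th) := by
  exact ⟨hI.isSpectral, fun a b => ⟨hI.implicationSet_eq_basicSet a b,
    imp a b, (hI.implicationSet_eq_basicSet a b).symm⟩⟩
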